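/- arXiv:2202.06560 — 3 statements merged into one kernel-verified Lean document; each statement's English description precedes it below -/
import Mathlib

section
/- Let N ≥ 1 and p, q ≥ 0 be integers and let U ⊆ ℝ^N be open. Let κ be a family of smooth functions κ^{α₁…α_p}_{β₁…β_q} : U → ℝ indexed by α₁,…,α_p, β₁,…,β_q ∈ {1,…,N} (the components of a (p,q)-tensor field), let π^{β₁…β_q}_{α₁…α_p} : U → ℝ be smooth (the components of a (q,p)-tensor field density), and let ζ = (ζ^1,…,ζ^N) : U → ℝ^N be smooth. Define the Lie derivative components (£_ζκ)^{α₁…α_p}_{β₁…β_q} := Σ_γ ζ^γ ∂_γκ^{α₁…α_p}_{β₁…β_q} − Σ_{r=1}^{p} Σ_γ κ^{α₁…α_{r−1} γ α_{r+1}…α_p}_{β₁…β_q} ∂_γ ζ^{α_r} + Σ_{r=1}^{q} Σ_γ κ^{α₁…α_p}_{β₁…β_{r−1} γ β_{r+1}…β_q} ∂_{β_r} ζ^γ, and define κ̂^{α₁…α_p ν}_{β₁…β_q μ} := Σ_{r=1}^{q} κ^{α₁…α_p}_{β₁…β_{r−1} μ β_{r+1}…β_q} δ^{ν}_{β_r}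 − Σ_{r=1}^{p} κ^{α₁…α_{r−1} ν α_{r+1}…α_p}_{β₁…β_q} δ^{α_r}_{μ}. Then, at every point of U and for every index μ-free full contraction, Σ_{α,β} (£_ζκ)^{α}_{β} π^{β}_{α} = Σ_μ ζ^μ ( Σ_{α,β} ∂_μ κ^{α}_{β} π^{β}_{α} − Σ_ν ∂_ν( Σ_{α,β} κ̂^{α ν}_{β μ} π^{β}_{α} ) ) + Σ_{μ,ν} ∂_ν( Σ_{α,β} κ̂^{α ν}_{β μ} π^{β}_{α} ζ^μ ), where α (resp. β) abbreviates the multi-index (α₁,…,α_p) (resp. (β₁,…,β_q)) and sums over α, β run over all multi-indices. -/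
noncomputable section

/-- The partial derivative `∂_γ f` of a function on `ℝ^N` in the `γ`-th coordinate
direction. -/
def pder {N : ℕ} (f : (Fin N → ℝ) → ℝ) (γ : Fin N) (x : Fin N → ℝ) : ℝ :=
  fderiv ℝ f x (Pi.single γ 1)

/-- The components `(£_ζ κ)^{α₁…α_p}_{β₁…β_q}` of the Lie derivative of the `(p,q)`-tensor
field with components `κ` along the vector field with components `ζ`. -/
def lieD {N p q : ℕ} (κ : (Fin p → Fin N) → (Fin q → Fin N) → (Fin N → ℝ) → ℝ)
    (ζ : Fin N → (Fin N → ℝ) → ℝ) (α : Fin p → Fin N) (β : Fin q → Fin N)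
    (x : Fin N → ℝ) : ℝ :=
  (∑ γ, ζ γ x * pder (κ α β) γ x)
    - (∑ r : Fin p, ∑ γ, κ (Function.update α r γ) β x * pder (ζ (α r)) γ x)
    + ∑ r : Fin q, ∑ γ, κ α (Function.update β r γ) x * pder (ζ γ) (β r) x

/-- The components `κ̂^{α₁…α_p ν}_{β₁…β_q μ}` of the `(p+1,q+1)`-tensor field associated
to `κ`. -/
def hatK {N p q : ℕ} (κ : (Fin p → Fin N) → (Fin q → Fin N) → (Fin N → ℝ) → ℝ)
    (α : Fin p → Fin N) (β : Fin q → Fin N) (ν μ : Fin N) (x : Fin N → ℝ) : ℝ :=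
  (∑ r : Fin q, κ α (Function.update β r μ) x * (if ν = β r then (1 : ℝ) else 0))
    - ∑ r : Fin p, κ (Function.update α r ν) β x * (if μ = α r then (1 : ℝ) else 0)

theorem pder_mul {N : ℕ} {f g : (Fin N → ℝ) → ℝ} {x : Fin N → ℝ}
    (hf : DifferentiableAt ℝ f x) (hg : DifferentiableAt ℝ g x) (γ : Fin N) :
    pder (fun z => f z * g z) γ x = f x * pder g γ x + g x * pder f γ x := by
  simp [pder, fderiv_fun_mul hf hg]

theorem differentiableAt_hatK {N p q : ℕ}
    {κ : (Fin p → Fin N) → (Fin q → Fin N) → (Fin N → ℝ) → ℝ} {x : Fin N → ℝ}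
    (hκ : ∀ α β, DifferentiableAt ℝ (κ α β) x) (α : Fin p → Fin N) (β : Fin q → Fin N)
    (ν μ : Fin N) : DifferentiableAt ℝ (hatK κ α β ν μ) x := by
  unfold hatK
  exact (DifferentiableAt.fun_sum fun r _ => (hκ _ _).mul_const _).sub
    (DifferentiableAt.fun_sum fun r _ => (hκ _ _).mul_const _)

/-- The Lie derivative is the directional derivative along `ζ` plus the contraction of `κ̂` with
the Jacobian of `ζ`. -/
theorem lieD_eq_add_hatK_contraction {N p q : ℕ}
    (κ : (Fin p → Fin N) → (Fin q → Fin N) → (Fin N → ℝ) → ℝ)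
    (ζ : Fin N → (Fin N → ℝ) → ℝ) (α : Fin p → Fin N) (β : Fin q → Fin N) (x : Fin N → ℝ) :
    lieD κ ζ α β x = (∑ μ, ζ μ x * pder (κ α β) μ x)
      + ∑ μ, ∑ ν, hatK κ α β ν μ x * pder (ζ μ) ν x := by
  have hβ : (∑ μ, ∑ ν, (∑ r : Fin q, κ α (Function.update β r μ) x *
        (if ν = β r then (1 : ℝ) else 0)) * pder (ζ μ) ν x)
      = ∑ r : Fin q, ∑ γ, κ α (Function.update β r γ) x * pder (ζ γ) (β r) x := by
    rw [Finset.sum_comm (γ := Fin q)]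
    refine Finset.sum_congr rfl fun μ _ => ?_
    simp_rw [Finset.sum_mul]
    rw [Finset.sum_comm]
    simp
  have hα : (∑ μ, ∑ ν, (∑ r : Fin p, κ (Function.update α r ν) β x *
        (if μ = α r then (1 : ℝ) else 0)) * pder (ζ μ) ν x)
      = ∑ r : Fin p, ∑ γ, κ (Function.update α r γ) β x * pder (ζ (α r)) γ x := by
    rw [Finset.sum_comm, Finset.sum_comm (γ := Fin p)]
    refine Finset.sum_congr rfl fun ν _ => ?_
    simp_rw [Finset.sum_mul]
    rw [Finset.sum_comm]
    simp
  simp only [lieD, hatK, sub_mul, Finset.sum_sub_distrib, hβ, hα]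
  ring

/-- Lemma 4.1 of the paper, in local coordinates: the full contraction
of the Lie derivative `£_ζ κ` with a tensor field density `π` decomposes as a term
proportional to `ζ` plus a total divergence. -/
theorem lie_derivative_contraction_identity
    (N p q : ℕ) (hN : 1 ≤ N) (U : Set (Fin N → ℝ)) (hU : IsOpen U)
    (κ : (Fin p → Fin N) → (Fin q → Fin N) → (Fin N → ℝ) → ℝ)
    (hκ : ∀ α β, ContDiffOn ℝ (⊤ : ℕ∞) (κ α β) U)
    (π : (Fin q → Fin N) → (Fin p → Fin N) → (Fin N → ℝ) → ℝ)
    (hπ : ∀ β α, ContDiffOn ℝ (⊤ : ℕ∞) (π β α) U)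
    (ζ : Fin N → (Fin N → ℝ) → ℝ)
    (hζ : ∀ γ, ContDiffOn ℝ (⊤ : ℕ∞) (ζ γ) U) :
    ∀ x ∈ U,
      (∑ α : Fin p → Fin N, ∑ β : Fin q → Fin N, lieD κ ζ α β x * π β α x)
      = (∑ μ, ζ μ x *
          ((∑ α : Fin p → Fin N, ∑ β : Fin q → Fin N, pder (κ α β) μ x * π β α x)
            - ∑ ν, pder (fun z => ∑ α : Fin p → Fin N, ∑ β : Fin q → Fin N,
                hatK κ α β ν μ z * π β α z) ν x))
        + ∑ μ, ∑ ν, pder (fun z => (∑ α : Fin p → Fin N, ∑ β : Fin q → Fin N,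
            hatK κ α β ν μ z * π β α z) * ζ μ z) ν x := by
  intro x hx
  have hdiff {f : (Fin N → ℝ) → ℝ} (hf : ContDiffOn ℝ (⊤ : ℕ∞) f U) : DifferentiableAt ℝ f x :=
    (hf.contDiffAt (hU.mem_nhds hx)).differentiableAt (by simp)
  have hF (ν μ : Fin N) : DifferentiableAt ℝ (fun z => ∑ α : Fin p → Fin N,
      ∑ β : Fin q → Fin N, hatK κ α β ν μ z * π β α z) x :=
    DifferentiableAt.fun_sum fun α _ => DifferentiableAt.fun_sum fun β _ =>
      (differentiableAt_hatK (fun α β => hdiff (hκ α β)) α β ν μ).mul (hdiff (hπ β α))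
  simp_rw [fun ν μ => pder_mul (hF ν μ) (hdiff (hζ μ)) ν]
  simp_rw [lieD_eq_add_hatK_contraction, Finset.sum_add_distrib, mul_sub,
    Finset.sum_sub_distrib, Finset.mul_sum (s := (Finset.univ : Finset (Fin N)))]
  have hζκ : (∑ α : Fin p → Fin N, ∑ β : Fin q → Fin N,
        (∑ μ, ζ μ x * pder (κ α β) μ x) * π β α x)
      = ∑ μ, ζ μ x * ∑ α : Fin p → Fin N, ∑ β : Fin q → Fin N,
          pder (κ α β) μ x * π β α x := by
    simp_rw [Finset.sum_mul, Finset.mul_sum]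
    simp_rw [Finset.sum_comm (s := (Finset.univ : Finset (Fin q → Fin N)))
      (t := (Finset.univ : Finset (Fin N)))]
    rw [Finset.sum_comm]
    simp only [mul_assoc]
  have hJ : (∑ α : Fin p → Fin N, ∑ β : Fin q → Fin N,
        (∑ μ, ∑ ν, hatK κ α β ν μ x * pder (ζ μ) ν x) * π β α x)
      = ∑ μ, ∑ ν, (∑ α : Fin p → Fin N, ∑ β : Fin q → Fin N,
          hatK κ α β ν μ x * π β α x) * pder (ζ μ) ν x := by
    simp_rw [← Fintype.sum_prod_type', Finset.sum_mul]
    rw [Finset.sum_comm]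
    simp only [mul_right_comm]
  simp_rw [add_mul, Finset.sum_add_distrib, hζκ, hJ]
  ring
end
end

section
/- Fix n ≥ 1, c > 0, a symmetric invertible (n+1)×(n+1) real matrix g with det g < 0, set m := √(−det g), and let e : ℝ_{>0} × ℝ → ℝ be smooth. On the open set O := {(w, ϱ̄, ς̄) ∈ ℝ^{n+1} × ℝ_{>0} × ℝ : g(w,w) < 0} define ℓ̄(w, ϱ̄, ς̄) := −(1/c) √(−g(w,w)) ( c² + e(ρ, η) ) ϱ̄ with ρ := √(−g(w,w)) ϱ̄/(c m) and η := ς̄/ϱ̄. Then for every (w, ϱ̄, ς̄) ∈ O and all indices μ, ν ∈ {0, …, n}: ( ℓ̄ − ϱ̄ ∂ℓ̄/∂ϱ̄ − ς̄ ∂ℓ̄/∂ς̄ ) δ^μ_ν + w^μ ∂ℓ̄/∂w^ν = ( p δ^μ_ν + c^{-2} (ε_tot + p) u^μ u_ν ) m, where u := c w/√(−g(w,w)), u_ν := Σ_λ g_{νλ} u^λ, p := ρ² ∂e/∂ρ(ρ,η) is the pressure, ε_tot := ρ ( c² + e(ρ,η) ) is the total energy density, and ∂ℓ̄/∂w^ν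 denotes the ν-th partial derivative of ℓ̄ with respect to w. -/
noncomputable section

/-- The bilinear evaluation `g(v,w) = Σ_{μν} g_{μν} v^μ w^ν` of a metric given in
components. -/
def quadg {n : ℕ} (g : Fin (n + 1) → Fin (n + 1) → ℝ) (v w : Fin (n + 1) → ℝ) : ℝ :=
  ∑ μ, ∑ ν, g μ ν * v μ * w ν

/-- The volume density `m = √(−det g)`. -/
def mvol {n : ℕ} (g : Fin (n + 1) → Fin (n + 1) → ℝ) : ℝ :=
  Real.sqrt (-(Matrix.of g).det)

/-- The proper mass density `ρ = √(−g(w,w)) ϱ̄ / (c m)`. -/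
def properRho {n : ℕ} (c : ℝ) (g : Fin (n + 1) → Fin (n + 1) → ℝ)
    (w : Fin (n + 1) → ℝ) (ϱ : ℝ) : ℝ :=
  Real.sqrt (-(quadg g w w)) * ϱ / (c * mvol g)

/-- The world-velocity `u = c w / √(−g(w,w))`. -/
def uvel {n : ℕ} (c : ℝ) (g : Fin (n + 1) → Fin (n + 1) → ℝ)
    (w : Fin (n + 1) → ℝ) : Fin (n + 1) → ℝ :=
  (c / Real.sqrt (-(quadg g w w))) • w

/-- The coordinate expression of the fluid spacetime Lagrangian density
`ℓ̄(w, ϱ̄, ς̄, g) = −(1/c) √(−g(w,w)) (c² + e(ρ,η)) ϱ̄`. -/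
def fluidL {n : ℕ} (c : ℝ) (e : ℝ → ℝ → ℝ) (g : Fin (n + 1) → Fin (n + 1) → ℝ)
    (w : Fin (n + 1) → ℝ) (ϱ ς : ℝ) : ℝ :=
  -(1 / c) * Real.sqrt (-(quadg g w w))
    * (c ^ 2 + e (properRho c g w ϱ) (ς / ϱ)) * ϱ

/-- The pressure `p = ρ² ∂e/∂ρ`. -/
def pressureF {n : ℕ} (c : ℝ) (e : ℝ → ℝ → ℝ) (g : Fin (n + 1) → Fin (n + 1) → ℝ)
    (w : Fin (n + 1) → ℝ) (ϱ ς : ℝ) : ℝ :=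
  (properRho c g w ϱ) ^ 2 * deriv (fun r => e r (ς / ϱ)) (properRho c g w ϱ)

/-- The total energy density `ε_tot = ρ (c² + e(ρ,η))`. -/
def energyTot {n : ℕ} (c : ℝ) (e : ℝ → ℝ → ℝ) (g : Fin (n + 1) → Fin (n + 1) → ℝ)
    (w : Fin (n + 1) → ℝ) (ϱ ς : ℝ) : ℝ :=
  properRho c g w ϱ * (c ^ 2 + e (properRho c g w ϱ) (ς / ϱ))

/-- The differential of `w ↦ g(w,w)` for a symmetric `g` has components `2 g_{νλ} w^λ`. -/
lemma hasFDerivAt_quadg {n : ℕ} (g : Fin (n + 1) → Fin (n + 1) → ℝ)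
    (hgsym : ∀ μ ν, g μ ν = g ν μ) (w : Fin (n + 1) → ℝ) :
    ∃ Q : (Fin (n + 1) → ℝ) →L[ℝ] ℝ, HasFDerivAt (fun v => quadg g v v) Q w ∧
      ∀ ν, Q (Pi.single ν 1) = 2 * ∑ l, g ν l * w l := by
  have hcoord (μ : Fin (n + 1)) : HasFDerivAt (fun v : Fin (n + 1) → ℝ => v μ)
      (ContinuousLinearMap.proj (R := ℝ) (φ := fun _ : Fin (n + 1) => ℝ) μ) w :=
    hasFDerivAt_apply μ w
  refine ⟨_, HasFDerivAt.fun_sum fun μ _ => HasFDerivAt.fun_sum fun ν _ =>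
    ((hcoord μ).const_mul (g μ ν)).mul (hcoord ν), fun ν => ?_⟩
  simp only [ContinuousLinearMap.proj_apply,
    sum_apply, add_apply,
    smul_apply, Pi.single_apply, smul_eq_mul, mul_ite, mul_one, mul_zero,
    Finset.sum_add_distrib]
  simp only [Finset.sum_ite_eq', Finset.mem_univ, if_true]
  rw [Finset.sum_comm]
  simp only [Finset.sum_ite_eq', Finset.mem_univ, if_true]
  rw [two_mul]
  congr 1
  · exact Finset.sum_congr rfl fun l _ => by rw [hgsym l ν]
  · exact Finset.sum_congr rfl fun l _ => mul_comm _ _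

/-- Chain rule along a curve for a function of two real variables. -/
lemma HasFDerivAt.hasDerivAt_comp_pair {e : ℝ → ℝ → ℝ} {E : ℝ × ℝ →L[ℝ] ℝ} {x y : ℝ → ℝ}
    {x' y' t : ℝ} (hE : HasFDerivAt (fun p : ℝ × ℝ => e p.1 p.2) E (x t, y t))
    (hx : HasDerivAt x x' t) (hy : HasDerivAt y y' t) :
    HasDerivAt (fun s => e (x s) (y s)) (x' * E (1, 0) + y' * E (0, 1)) t := by
  have h := hE.comp_hasDerivAt t (hx.prodMk hy)
  have hsplit : ((x', y') : ℝ × ℝ) = x' • ((1, 0) : ℝ × ℝ) + y' • ((0, 1) : ℝ × ℝ) := by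
    simp
  rw [hsplit, map_add, map_smul, map_smul] at h
  exact h

/-- The canonical stress-energy-momentum tensor
`(ℓ̄ − ϱ̄ ∂ℓ̄/∂ϱ̄ − ς̄ ∂ℓ̄/∂ς̄) δ^μ_ν + w^μ ∂ℓ̄/∂w^ν` of the relativistic fluid equals the
perfect fluid form `(p δ^μ_ν + c⁻² (ε_tot + p) u^μ u_ν) m`. -/
theorem fluid_stress_energy_momentum_tensor
    (n : ℕ) (hn : 1 ≤ n) (c : ℝ) (hc : 0 < c)
    (g : Fin (n + 1) → Fin (n + 1) → ℝ) (hgsym : ∀ μ ν, g μ ν = g ν μ)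
    (hgdet : (Matrix.of g).det < 0)
    (e : ℝ → ℝ → ℝ)
    (he : ContDiffOn ℝ (⊤ : ℕ∞) (fun p : ℝ × ℝ => e p.1 p.2)
      (Set.Ioi (0 : ℝ) ×ˢ (Set.univ : Set ℝ)))
    (w : Fin (n + 1) → ℝ) (ϱ ς : ℝ) (hϱ : 0 < ϱ) (hw : quadg g w w < 0) :
    ∀ μ ν : Fin (n + 1),
      (fluidL c e g w ϱ ς
            - ϱ * deriv (fun r => fluidL c e g w r ς) ϱ
            - ς * deriv (fun s => fluidL c e g w ϱ s) ς) * (if μ = ν then (1 : ℝ) else 0)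
          + w μ * fderiv ℝ (fun w' => fluidL c e g w' ϱ ς) w (Pi.single ν 1)
        = (pressureF c e g w ϱ ς * (if μ = ν then (1 : ℝ) else 0)
            + (c ^ 2)⁻¹ * (energyTot c e g w ϱ ς + pressureF c e g w ϱ ς)
              * uvel c g w μ * (∑ l, g ν l * uvel c g w l)) * mvol g := by
  intro μ ν
  have hm : 0 < mvol g := Real.sqrt_pos.2 (by linarith)
  have hN : 0 < Real.sqrt (-(quadg g w w)) := Real.sqrt_pos.2 (by linarith)
  have hρ : 0 < properRho c g w ϱ := by unfold properRho; positivity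
  obtain ⟨E, hE⟩ : DifferentiableAt ℝ (fun p : ℝ × ℝ => e p.1 p.2)
      (properRho c g w ϱ, ς / ϱ) :=
    (he.contDiffAt ((isOpen_Ioi.prod isOpen_univ).mem_nhds
      (Set.mk_mem_prod (Set.mem_Ioi.2 hρ) (Set.mem_univ _)))).differentiableAt
      (by simp)
  obtain ⟨Q, hQ, hQν⟩ := hasFDerivAt_quadg g hgsym w
  have hpress : deriv (fun r => e r (ς / ϱ)) (properRho c g w ϱ) = E (1, 0) := by
    have h := HasFDerivAt.hasDerivAt_comp_pair (x := id) (y := fun _ => ς / ϱ) hE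
      (hasDerivAt_id (properRho c g w ϱ)) (hasDerivAt_const _ _)
    exact h.deriv.trans (by simp)
  have hderivϱ := (((HasFDerivAt.hasDerivAt_comp_pair
      (x := fun r => properRho c g w r) (y := fun r => ς / r) hE
      (((hasDerivAt_id ϱ).const_mul (Real.sqrt (-(quadg g w w)))).div_const (c * mvol g))
      ((hasDerivAt_const ϱ ς).div (hasDerivAt_id ϱ) hϱ.ne')).const_add (c ^ 2)).const_mul
      (-(1 / c) * Real.sqrt (-(quadg g w w)))).mul (hasDerivAt_id ϱ)
  have hderivς := (((HasFDerivAt.hasDerivAt_comp_pair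
      (x := fun _ => properRho c g w ϱ) (y := fun s => s / ϱ) hE
      (hasDerivAt_const ς _) ((hasDerivAt_id ς).div_const ϱ)).const_add (c ^ 2)).const_mul
      (-(1 / c) * Real.sqrt (-(quadg g w w)))).mul_const ϱ
  have hsqrt := (hasDerivAt_neg (quadg g w w)).sqrt (by linarith)
  have hderivq := ((hsqrt.const_mul (-(1 / c))).mul ((HasFDerivAt.hasDerivAt_comp_pair
      (x := fun q => Real.sqrt (-q) * ϱ / (c * mvol g)) (y := fun _ => ς / ϱ) hE
      ((hsqrt.mul_const ϱ).div_const (c * mvol g))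
      (hasDerivAt_const _ _)).const_add (c ^ 2))).mul_const ϱ
  have hderivw := HasDerivAt.comp_hasFDerivAt (f := fun v => quadg g v v) w hderivq hQ
  have h₁ : deriv (fun r => fluidL c e g w r ς) ϱ = _ := hderivϱ.deriv
  have h₂ : deriv (fun s => fluidL c e g w ϱ s) ς = _ := hderivς.deriv
  have h₃ : fderiv ℝ (fun w' => fluidL c e g w' ϱ ς) w = _ := hderivw.fderiv
  have hu : ∑ l, g ν l * uvel c g w l
      = c / Real.sqrt (-(quadg g w w)) * ∑ l, g ν l * w l := by
    rw [Finset.mul_sum]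
    exact Finset.sum_congr rfl fun l _ => by simp only [uvel, Pi.smul_apply, smul_eq_mul]; ring
  rw [h₁, h₂, h₃, hu]
  simp only [smul_apply, smul_eq_mul, hQν, pressureF, energyTot, hpress,
    fluidL, uvel, Pi.smul_apply, id]
  have hρdef : properRho c g w ϱ = Real.sqrt (-(quadg g w w)) * ϱ / (c * mvol g) := rfl
  rw [← hρdef]
  generalize e (properRho c g w ϱ) (ς / ϱ) = ε
  rw [hρdef]
  generalize Real.sqrt (-(quadg g w w)) = N at hN ⊢
  generalize mvol g = m at hm ⊢
  generalize (if μ = ν then (1 : ℝ) else 0) = δ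
  field_simp
  ring
end
end

section
/- Fix n ≥ 1, c > 0, and let e : ℝ_{>0} × ℝ → ℝ be smooth. On the open set of tuples (w, ϱ̄, ς̄, g) with ϱ̄ > 0, g a symmetric invertible (n+1)×(n+1) real matrix with det g < 0 and g(w,w) < 0, define ℓ̄(w, ϱ̄, ς̄, g) := −(1/c) √(−g(w,w)) ( c² + e(ρ, η) ) ϱ̄ with m := √(−det g), ρ := √(−g(w,w)) ϱ̄/(c m), and η := ς̄/ϱ̄. Then for every such tuple and every symmetric (n+1)×(n+1) matrix a, the derivative of g ↦ ℓ̄(w, ϱ̄, ς̄, g) at g in direction a equals (1/2) m Σ_{μ,ν} T^{μν} a_{μν}, where T^{μν} := p g^{μν} + c^{-2} (ε_tot + p) u^μ u^ν, with g^{μν} the inverse matrix entries, u := c w/√(−g(w,w)), p := ρ² ∂e/∂ρ(ρ,η), and ε_tot := ρ ( c² + e(ρ,η) ). -/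
noncomputable section

/-- Jacobi's formula at an invertible matrix, along a line. -/
theorem hasDerivAt_det_add_smul {m : Type*} [Fintype m] [DecidableEq m]
    (G A : Matrix m m ℝ) (hG : G.det ≠ 0) :
    HasDerivAt (fun t : ℝ => (G + t • A).det) (G.det * (G⁻¹ * A).trace) 0 := by
  have hfactor : ∀ t : ℝ, (G + t • A).det = G.det * (1 + t • (G⁻¹ * A)).det := by
    intro t
    rw [← Matrix.det_mul, mul_add, mul_one, Matrix.mul_smul,
      Matrix.mul_nonsing_inv_cancel_left _ _ (isUnit_iff_ne_zero.mpr hG)]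
  simp_rw [hfactor]
  rw [funext fun t => congrArg (G.det * ·) (Matrix.det_one_add_smul t (G⁻¹ * A))]
  set P := (Matrix.det (1 + (Polynomial.X : Polynomial ℝ) •
    (G⁻¹ * A).map Polynomial.C)).divX.divX
  have h := ((((hasDerivAt_id (0 : ℝ)).const_mul (G⁻¹ * A).trace).const_add 1).add
    ((P.hasDerivAt 0).mul ((hasDerivAt_id (0 : ℝ)).pow 2))).const_mul G.det
  refine h.congr_deriv ?_
  simp

theorem mvol_pos {n : ℕ} {g : Fin (n + 1) → Fin (n + 1) → ℝ}
    (hg : (Matrix.of g).det < 0) : 0 < mvol g :=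
  Real.sqrt_pos.mpr (neg_pos.mpr hg)

theorem properRho_pos {n : ℕ} {c : ℝ} (hc : 0 < c) {g : Fin (n + 1) → Fin (n + 1) → ℝ}
    (hg : (Matrix.of g).det < 0) {w : Fin (n + 1) → ℝ} (hw : quadg g w w < 0)
    {ϱ : ℝ} (hϱ : 0 < ϱ) : 0 < properRho c g w ϱ :=
  div_pos (mul_pos (Real.sqrt_pos.mpr (neg_pos.mpr hw)) hϱ) (mul_pos hc (mvol_pos hg))

theorem differentiable_quadg {n : ℕ} (v w : Fin (n + 1) → ℝ) :
    Differentiable ℝ (fun g : Fin (n + 1) → Fin (n + 1) → ℝ => quadg g v w) := by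
  unfold quadg
  fun_prop

theorem differentiable_det_of {n : ℕ} :
    Differentiable ℝ (fun g : Fin (n + 1) → Fin (n + 1) → ℝ => (Matrix.of g).det) := by
  simp only [Matrix.det_apply, Matrix.of_apply]
  fun_prop

theorem differentiableAt_properRho {n : ℕ} {c : ℝ} (hc : 0 < c)
    {g : Fin (n + 1) → Fin (n + 1) → ℝ} (hg : (Matrix.of g).det < 0)
    {w : Fin (n + 1) → ℝ} (hw : quadg g w w < 0) (ϱ : ℝ) :
    DifferentiableAt ℝ (fun g' => properRho c g' w ϱ) g := by
  have hs : DifferentiableAt ℝ (fun g' => Real.sqrt (-(quadg g' w w))) g :=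
    ((differentiable_quadg w w) g).neg.sqrt (neg_pos.mpr hw).ne'
  have hm : DifferentiableAt ℝ (fun g' : Fin (n + 1) → Fin (n + 1) → ℝ => mvol g') g :=
    (differentiable_det_of g).neg.sqrt (neg_pos.mpr hg).ne'
  unfold properRho
  simp_rw [div_eq_mul_inv]
  exact (hs.mul_const ϱ).fun_mul ((hm.const_mul c).fun_inv (mul_pos hc (mvol_pos hg)).ne')

theorem differentiableAt_fluidL {n : ℕ} {c : ℝ} (hc : 0 < c) {e : ℝ → ℝ → ℝ}
    {g : Fin (n + 1) → Fin (n + 1) → ℝ} (hg : (Matrix.of g).det < 0)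
    {w : Fin (n + 1) → ℝ} (hw : quadg g w w < 0) {ϱ ς : ℝ}
    (he : DifferentiableAt ℝ (fun r => e r (ς / ϱ)) (properRho c g w ϱ)) :
    DifferentiableAt ℝ (fun g' => fluidL c e g' w ϱ ς) g := by
  have hs : DifferentiableAt ℝ (fun g' => Real.sqrt (-(quadg g' w w))) g :=
    ((differentiable_quadg w w) g).neg.sqrt (neg_pos.mpr hw).ne'
  have he' : DifferentiableAt ℝ (fun g' => e (properRho c g' w ϱ) (ς / ϱ)) g :=
    DifferentiableAt.comp (g := fun r => e r (ς / ϱ)) g he (differentiableAt_properRho hc hg hw ϱ)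
  exact ((hs.const_mul _).mul (he'.const_add _)).mul_const ϱ

theorem quadg_add_smul {n : ℕ} (g a : Fin (n + 1) → Fin (n + 1) → ℝ)
    (v w : Fin (n + 1) → ℝ) (t : ℝ) :
    quadg (g + t • a) v w = quadg g v w + t * quadg a v w := by
  simp only [quadg, Pi.add_apply, Pi.smul_apply, smul_eq_mul, Finset.mul_sum,
    ← Finset.sum_add_distrib]
  exact Finset.sum_congr rfl fun _ _ => Finset.sum_congr rfl fun _ _ => by ring

theorem hasLineDerivAt_sqrt_quadg {n : ℕ} {g : Fin (n + 1) → Fin (n + 1) → ℝ}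
    {w : Fin (n + 1) → ℝ} (hw : quadg g w w < 0) (a : Fin (n + 1) → Fin (n + 1) → ℝ) :
    HasLineDerivAt ℝ (fun g' => Real.sqrt (-(quadg g' w w)))
      (-(quadg a w w) / (2 * Real.sqrt (-(quadg g w w)))) g a := by
  have hq : HasDerivAt (fun t : ℝ => quadg (g + t • a) w w) (quadg a w w) 0 := by
    simp_rw [quadg_add_smul]
    simpa using ((hasDerivAt_id (0 : ℝ)).mul_const (quadg a w w)).const_add (quadg g w w)
  have h := hq.fun_neg.sqrt (by simpa using hw.ne)
  simp only [zero_smul, add_zero] at h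
  exact h

theorem hasLineDerivAt_mvol {n : ℕ} {g : Fin (n + 1) → Fin (n + 1) → ℝ}
    (hg : (Matrix.of g).det < 0) (a : Fin (n + 1) → Fin (n + 1) → ℝ) :
    HasLineDerivAt ℝ (fun g' : Fin (n + 1) → Fin (n + 1) → ℝ => mvol g')
      (mvol g / 2 * ((Matrix.of g)⁻¹ * Matrix.of a).trace) g a := by
  have hd : HasDerivAt (fun t : ℝ => (Matrix.of (g + t • a)).det)
      ((Matrix.of g).det * ((Matrix.of g)⁻¹ * Matrix.of a).trace) 0 :=
    hasDerivAt_det_add_smul (Matrix.of g) (Matrix.of a) hg.ne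
  have h := hd.fun_neg.sqrt (by simpa using hg.ne)
  simp only [zero_smul, add_zero] at h
  have hm : 0 < √(-(Matrix.of g).det) := mvol_pos hg
  have hsq := Real.sq_sqrt (neg_pos.mpr hg).le
  unfold HasLineDerivAt mvol
  refine h.congr_deriv ?_
  field_simp
  rw [hsq]
  ring

/-- The derivative of the fluid Lagrangian density along a line of metrics, in terms of
`a(w,w)` and the trace of `g⁻¹ a`. -/
theorem hasLineDerivAt_fluidL {n : ℕ} {c : ℝ} (hc : 0 < c) {e : ℝ → ℝ → ℝ}
    {g : Fin (n + 1) → Fin (n + 1) → ℝ} (hg : (Matrix.of g).det < 0)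
    {w : Fin (n + 1) → ℝ} (hw : quadg g w w < 0) {ϱ ς : ℝ}
    (he : DifferentiableAt ℝ (fun r => e r (ς / ϱ)) (properRho c g w ϱ))
    (a : Fin (n + 1) → Fin (n + 1) → ℝ) :
    HasLineDerivAt ℝ (fun g' => fluidL c e g' w ϱ ς)
      (1 / 2 * mvol g * (pressureF c e g w ϱ ς * ((Matrix.of g)⁻¹ * Matrix.of a).trace
        + (energyTot c e g w ϱ ς + pressureF c e g w ϱ ς)
          * (quadg a w w / Real.sqrt (-(quadg g w w)) ^ 2))) g a := by
  have hs : HasDerivAt (fun t : ℝ => Real.sqrt (-(quadg (g + t • a) w w))) _ 0 :=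
    hasLineDerivAt_sqrt_quadg hw a
  have hm : HasDerivAt (fun t : ℝ => mvol (g + t • a)) _ 0 := hasLineDerivAt_mvol hg a
  have hspos := Real.sqrt_pos.mpr (neg_pos.mpr hw)
  have hmpos := mvol_pos hg
  have hρ : HasDerivAt (fun t : ℝ => properRho c (g + t • a) w ϱ) _ 0 :=
    (hs.mul_const ϱ).fun_div (hm.const_mul c) (by simpa using ⟨hc.ne', hmpos.ne'⟩)
  have he' : HasDerivAt (fun t : ℝ => e (properRho c (g + t • a) w ϱ) (ς / ϱ)) _ 0 :=
    HasDerivAt.comp (h₂ := fun r => e r (ς / ϱ))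
      (h₂' := deriv (fun r => e r (ς / ϱ)) (properRho c g w ϱ)) 0
      (by simpa using he.hasDerivAt) hρ
  have h := ((hs.const_mul (-(1 / c))).fun_mul (he'.const_add (c ^ 2))).mul_const ϱ
  simp only [zero_smul, add_zero] at h
  unfold HasLineDerivAt fluidL
  refine h.congr_deriv ?_
  unfold pressureF energyTot
  generalize deriv (fun r => e r (ς / ϱ)) (properRho c g w ϱ) = e₁
  generalize e (properRho c g w ϱ) (ς / ϱ) = e₀
  unfold properRho
  field_simp
  ring

/-- Contraction of a perfect-fluid tensor with a symmetric tensor. -/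
theorem sum_perfectFluid_mul {n : ℕ} {c : ℝ} (hc : c ≠ 0)
    (g : Fin (n + 1) → Fin (n + 1) → ℝ) (w : Fin (n + 1) → ℝ) (p q : ℝ)
    {a : Fin (n + 1) → Fin (n + 1) → ℝ} (ha : ∀ μ ν, a μ ν = a ν μ) :
    ∑ μ, ∑ ν, (p * (Matrix.of g)⁻¹ μ ν
        + (c ^ 2)⁻¹ * q * uvel c g w μ * uvel c g w ν) * a μ ν
      = p * ((Matrix.of g)⁻¹ * Matrix.of a).trace
        + q * (quadg a w w / Real.sqrt (-(quadg g w w)) ^ 2) := by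
  simp only [Matrix.trace, Matrix.diag_apply, Matrix.mul_apply, Matrix.of_apply, uvel,
    Pi.smul_apply, smul_eq_mul, Finset.mul_sum, quadg.eq_1 a, Finset.sum_div,
    ← Finset.sum_add_distrib]
  refine Finset.sum_congr rfl fun μ _ => Finset.sum_congr rfl fun ν _ => ?_
  rw [ha ν μ]
  field_simp

/-- The derivative of the fluid Lagrangian density with respect to the
metric, in a symmetric direction `a`, is `(1/2) m Σ_{μν} T^{μν} a_{μν}` where
`T^{μν} = p g^{μν} + c⁻² (ε_tot + p) u^μ u^ν` is the perfect fluid (Hilbert)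
stress-energy tensor. -/
theorem fluid_metric_variation_hilbert_tensor
    (n : ℕ) (hn : 1 ≤ n) (c : ℝ) (hc : 0 < c)
    (e : ℝ → ℝ → ℝ)
    (he : ContDiffOn ℝ (⊤ : ℕ∞) (fun p : ℝ × ℝ => e p.1 p.2)
      (Set.Ioi (0 : ℝ) ×ˢ (Set.univ : Set ℝ)))
    (g : Fin (n + 1) → Fin (n + 1) → ℝ) (hgsym : ∀ μ ν, g μ ν = g ν μ)
    (hgdet : (Matrix.of g).det < 0)
    (w : Fin (n + 1) → ℝ) (ϱ ς : ℝ) (hϱ : 0 < ϱ) (hw : quadg g w w < 0) :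
    ∀ a : Fin (n + 1) → Fin (n + 1) → ℝ, (∀ μ ν, a μ ν = a ν μ) →
      fderiv ℝ (fun g' => fluidL c e g' w ϱ ς) g a
        = (1 / 2) * mvol g * ∑ μ, ∑ ν,
            (pressureF c e g w ϱ ς * (Matrix.of g)⁻¹ μ ν
              + (c ^ 2)⁻¹ * (energyTot c e g w ϱ ς + pressureF c e g w ϱ ς)
                * uvel c g w μ * uvel c g w ν) * a μ ν := by
  intro a ha
  have he' : DifferentiableAt ℝ (fun r => e r (ς / ϱ)) (properRho c g w ϱ) := by
    have hmem : Set.Ioi (0 : ℝ) ×ˢ (Set.univ : Set ℝ) ∈ nhds (properRho c g w ϱ, ς / ϱ) :=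
      (isOpen_Ioi.prod isOpen_univ).mem_nhds ⟨properRho_pos hc hgdet hw hϱ, trivial⟩
    have hd := (he.contDiffAt hmem).differentiableAt (by simp)
    exact hd.comp (properRho c g w ϱ) (f := fun r => (r, ς / ϱ)) (by fun_prop)
  rw [← (differentiableAt_fluidL hc hgdet hw he').lineDeriv_eq_fderiv,
    (hasLineDerivAt_fluidL hc hgdet hw he' a).lineDeriv,
    sum_perfectFluid_mul hc.ne' g w _ _ ha]
end
end
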